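/- arXiv:cs/0701071 — 2 statements merged into one kernel-verified Lean document; each statement's English description precedes it below -/
import Mathlib

section
/- There is a constant c > 0 such that for every integer n ≥ 2, every integer k with 2 ≤ k < n, and every stable wiring s for the uniform (n,k)-BDNF game, if r is a node of minimum cost (c_r(s) ≤ c_v(s) for all v), then d_s(r,v) ≤ c·√n for every node v. -/
namespace BDNF

variable {V : Type} [DecidableEq V]

/-- `connIn s m v u` : there is a directed path with at most `m` edges from `v`
to `u` in the directed graph defined by the wiring `s`. -/
def connIn (s : V → Finset V) : ℕ → V → V → Prop
  | 0, v, u => v = u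
  | m + 1, v, u => v = u ∨ ∃ w ∈ s v, connIn s m w u

/-- Directed hop distance from `v` to `u`, with disconnection penalty `M`. -/
noncomputable def distW (s : V → Finset V) (M : ℕ) (v u : V) : ℕ := by
  classical exact if h : ∃ m, connIn s m v u then Nat.find h else M

/-- Cost of node `v` in the uniform game: the sum of its distances to all
other nodes. -/
noncomputable def cost [Fintype V] (s : V → Finset V) (M : ℕ) (v : V) : ℕ :=
  ∑ u ∈ Finset.univ.filter (fun u => u ≠ v), distW s M v u

/-- `s` is a wiring with out-degree bound `k`: every node links to at most `k`
other nodes. -/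
def IsWiring (k : ℕ) (s : V → Finset V) : Prop :=
  ∀ v, v ∉ s v ∧ (s v).card ≤ k

/-- `s` is stable (a pure Nash equilibrium) for the uniform game: no node can
strictly decrease its cost by rewiring its own out-links. -/
def Stable [Fintype V] (k M : ℕ) (s : V → Finset V) : Prop :=
  ∀ (v : V) (t : Finset V), v ∉ t → t.card ≤ k →
    cost s M v ≤ cost (Function.update s v t) M v

section

set_option linter.unusedSectionVars false

variable {s : V → Finset V} {M : ℕ}

theorem connIn_refl (s : V → Finset V) (m : ℕ) (v : V) : connIn s m v v := by
  cases m with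
  | zero => rfl
  | succ m => exact Or.inl rfl

theorem connIn_succ {m : ℕ} {v w u : V} (hw : w ∈ s v) (h : connIn s m w u) :
    connIn s (m + 1) v u := Or.inr ⟨w, hw, h⟩

theorem connIn_mono {m m' : ℕ} (hm : m ≤ m') {v u : V} (h : connIn s m v u) :
    connIn s m' v u := by
  induction m generalizing m' v with
  | zero => obtain rfl : v = u := h; exact connIn_refl s m' v
  | succ m ih =>
    obtain ⟨l, rfl⟩ : ∃ l, m' = l + 1 := ⟨m' - 1, by omega⟩
    rcases h with rfl | ⟨w, hw, h⟩
    · exact connIn_refl s _ v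
    · exact connIn_succ hw (ih (by omega) h)

theorem connIn_trans {a b : ℕ} {v w u : V} (h : connIn s a v w) (h' : connIn s b w u) :
    connIn s (a + b) v u := by
  induction a generalizing v with
  | zero => obtain rfl : v = w := h; simpa using h'
  | succ a ih =>
    rcases h with rfl | ⟨x, hx, h⟩
    · exact connIn_mono (by omega) h'
    · rw [Nat.add_right_comm]
      exact connIn_succ hx (ih h)

theorem mem_of_connIn {A : Set V} (hA : ∀ v ∈ A, ∀ w ∈ s v, w ∈ A) {m : ℕ} {v u : V}
    (hv : v ∈ A) (h : connIn s m v u) : u ∈ A := by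
  induction m generalizing v with
  | zero => obtain rfl : v = u := h; exact hv
  | succ m ih =>
    rcases h with rfl | ⟨w, hw, h⟩
    · exact hv
    · exact ih (hA v hv w hw) h

/-- Rewiring `u` does not destroy a path whose length is at most the distance to `u`. -/
theorem connIn_update (u : V) (t : Finset V) {m : ℕ} {v w : V}
    (hu : ∀ j < m, ¬ connIn s j v u) (h : connIn s m v w) :
    connIn (Function.update s u t) m v w := by
  induction m generalizing v with
  | zero => exact h
  | succ m ih =>
    rcases h with rfl | ⟨x, hx, h⟩
    · exact connIn_refl _ _ v
    · have hvu : v ≠ u := hu 0 (by omega)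
      refine connIn_succ (by rwa [Function.update_of_ne hvu]) (ih (fun j hj hc => ?_) h)
      exact hu (j + 1) (by omega) (connIn_succ hx hc)

theorem distW_le {m : ℕ} {v u : V} (h : connIn s m v u) : distW s M v u ≤ m := by
  classical
  rw [distW, dif_pos ⟨m, h⟩]
  exact Nat.find_min' _ h

theorem connIn_distW {v u : V} (h : ∃ m, connIn s m v u) : connIn s (distW s M v u) v u := by
  classical
  rw [distW, dif_pos h]
  exact Nat.find_spec h

theorem distW_eq_penalty {v u : V} (h : ¬ ∃ m, connIn s m v u) : distW s M v u = M := by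
  rw [distW, dif_neg h]

theorem distW_self (v : V) : distW s M v v = 0 :=
  Nat.le_zero.1 (distW_le (connIn_refl s 0 v))

/-- A directed path of length exactly the distance, listed vertex by vertex. -/
theorem exists_shortest_path {D : ℕ} {v u : V} (h : connIn s D v u)
    (hmin : ∀ j < D, ¬ connIn s j v u) :
    ∃ p : ℕ → V, p 0 = v ∧ p D = u ∧ ∀ j < D, p (j + 1) ∈ s (p j) := by
  induction D generalizing v with
  | zero => exact ⟨fun _ => v, rfl, h, by simp⟩
  | succ D ih =>
    rcases h with rfl | ⟨x, hx, h⟩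
    · exact absurd (connIn_refl s 0 v) (hmin 0 (by omega))
    · obtain ⟨p, h0, hD, hp⟩ := ih h fun j hj hc => hmin (j + 1) (by omega) (connIn_succ hx hc)
      refine ⟨fun j => Nat.casesOn j v p, rfl, hD, fun j hj => ?_⟩
      cases j with
      | zero => simpa [h0] using hx
      | succ j => exact hp j (by omega)

theorem connIn_of_path {D : ℕ} {p : ℕ → V} (hp : ∀ j < D, p (j + 1) ∈ s (p j)) {a b : ℕ}
    (hab : a + b ≤ D) : connIn s b (p a) (p (a + b)) := by
  induction b generalizing a with
  | zero => rfl
  | succ b ih =>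
    have := ih (a := a + 1) (by omega)
    rw [Nat.add_right_comm] at this
    exact connIn_succ (hp a (by omega)) this

variable [Fintype V]

theorem cost_add_distW (M : ℕ) (s : V → Finset V) (r u : V) :
    (∑ w ∈ Finset.univ.filter (fun w => w ≠ u), distW s M r w) + distW s M r u
      = cost s M r := by
  have split (x : V) : (∑ w ∈ Finset.univ.filter (fun w => w ≠ x), distW s M r w)
      + distW s M r x = ∑ w, distW s M r w := by
    rw [Finset.filter_ne']
    exact Finset.sum_erase_add _ _ (Finset.mem_univ x)
  rw [split u, ← split r, distW_self, add_zero, cost]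

/-- In a stable wiring a node of minimum cost reaches every node. -/
theorem Stable.exists_connIn {k : ℕ} (hs : Stable k M s) (hk : 1 ≤ k)
    (hM : Fintype.card V ≤ M) {r : V} (hr : ∀ v, cost s M r ≤ cost s M v) (u : V) :
    ∃ m, connIn s m r u := by
  by_contra hu
  have hru : u ≠ r := by rintro rfl; exact hu ⟨0, rfl⟩
  have hsu := hs u {r} (by simpa using hru) (by simpa using hk)
  set s' := Function.update s u {r} with hs'
  have hsr : r ∈ s' u := by simp [hs']
  have hle : ∀ w ∈ Finset.univ.filter (fun w => w ≠ u),
      distW s' M u w ≤ distW s M r w + 1 := by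
    intro w hw
    have hwu : w ≠ u := by simpa using hw
    by_cases hrw : ∃ m, connIn s m r w
    · exact distW_le (connIn_succ hsr
        (connIn_update u {r} (fun j _ hc => hu ⟨j, hc⟩) (connIn_distW hrw)))
    · rw [distW_eq_penalty hrw, distW_eq_penalty]
      · omega
      rintro ⟨m, hm⟩
      have hclosed : ∀ v ∈ {x | x = u ∨ ∃ m, connIn s m r x}, ∀ y ∈ s' v,
          y ∈ {x | x = u ∨ ∃ m, connIn s m r x} := by
        intro v hv y hy
        by_cases hvu : v = u
        · subst hvu
          obtain rfl : y = r := by simpa [hs'] using hy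
          exact Or.inr ⟨0, rfl⟩
        · obtain ⟨a, ha⟩ := hv.resolve_left hvu
          rw [hs', Function.update_of_ne hvu] at hy
          exact Or.inr ⟨a + 1, connIn_trans ha (connIn_succ (m := 0) hy rfl)⟩
      rcases mem_of_connIn hclosed (Or.inl rfl) hm with h | h
      · exact hwu h
      · exact hrw h
  have hsum := Finset.sum_le_sum hle
  have hcard : (Finset.univ.filter (fun w => w ≠ u)).card + 1 = Fintype.card V := by
    rw [Finset.filter_ne', Finset.card_erase_add_one (Finset.mem_univ u), Finset.card_univ]
  rw [Finset.sum_add_distrib, Finset.sum_const, smul_eq_mul, mul_one] at hsum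
  have hsplit := cost_add_distW M s r u
  rw [distW_eq_penalty hu] at hsplit
  have hru' := hr u
  change cost s' M u ≤ _ at hsum
  omega

/-- If a farthest node from a minimum-cost node `r` of a stable wiring, at distance `D ≥ 1`,
rewires to `r` and to the `i`-th node of a shortest path from `r` to itself, stability bounds
its savings. -/
theorem Stable.mul_sub_lt_card {k : ℕ} (hs : Stable k M s) (hk : 2 ≤ k) {r u : V}
    (hr : ∀ v, cost s M r ≤ cost s M v) (hreach : ∀ v, ∃ m, connIn s m r v)
    (hfar : ∀ v, distW s M r v ≤ distW s M r u) {i : ℕ} (hi : i < distW s M r u) :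
    i * (distW s M r u - i) + distW s M r u < Fintype.card V := by
  set D := distW s M r u with hD
  have hmin : ∀ j < D, ¬ connIn s j r u := fun j hj hc =>
    absurd (distW_le (M := M) hc) (by omega)
  obtain ⟨p, hp0, hpD, hp⟩ := exists_shortest_path (connIn_distW (hreach u)) hmin
  have hdist : ∀ j ≤ D, distW s M r (p j) = j := by
    intro j hj
    apply le_antisymm
    · have := connIn_of_path hp (a := 0) (b := j) (by omega)
      rw [hp0, zero_add] at this
      exact distW_le this
    · by_contra! hlt
      have := connIn_of_path hp (a := j) (b := D - j) (by omega)
      rw [Nat.add_sub_cancel' hj, hpD] at this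
      exact hmin _ (by omega) (connIn_trans (connIn_distW (M := M) (hreach _)) this)
  have hpu : ∀ j < D, p j ≠ u := by
    intro j hj h
    have := hdist j hj.le
    rw [h] at this
    omega
  have hsu := hs u {r, p i}
    (by simpa [← hp0] using ⟨(hpu 0 (by omega)).symm, (hpu i hi).symm⟩)
    (Finset.card_le_two.trans hk)
  set s' := Function.update s u {r, p i} with hs'
  have hp' : ∀ j < D, p (j + 1) ∈ s' (p j) := fun j hj => by
    rw [hs', Function.update_of_ne (hpu j hj)]
    exact hp j hj
  set P := (Finset.Ico i D).image p with hP
  have hPcard : P.card = D - i := by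
    rw [hP, Finset.card_image_of_injOn, Nat.card_Ico]
    intro a ha b hb hab
    simp only [Finset.coe_Ico, Set.mem_Ico] at ha hb
    rw [← hdist a ha.2.le, hab, hdist b hb.2.le]
  have hle : ∀ w ∈ Finset.univ.filter (fun w => w ≠ u),
      distW s' M u w + (if w ∈ P then i else 0) ≤ distW s M r w + 1 := by
    intro w _
    split_ifs with hw
    · obtain ⟨j, hj, rfl⟩ := Finset.mem_image.1 hw
      rw [Finset.mem_Ico] at hj
      have := connIn_of_path hp' (a := i) (b := j - i) (by omega)
      rw [Nat.add_sub_cancel' hj.1] at this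
      have hd : distW s' M u (p j) ≤ j - i + 1 := distW_le (connIn_succ (by simp [hs']) this)
      rw [hdist j hj.2.le]
      omega
    · refine distW_le (connIn_succ (w := r) (by simp [hs'])
        (connIn_update u _ (fun j hj => hmin j (hj.trans_le (hfar w))) (connIn_distW (hreach w))))
  have hsum := Finset.sum_le_sum hle
  have hcard : (Finset.univ.filter (fun w => w ≠ u)).card + 1 = Fintype.card V := by
    rw [Finset.filter_ne', Finset.card_erase_add_one (Finset.mem_univ u), Finset.card_univ]
  have hPsub : (Finset.univ.filter (fun w => w ≠ u)).filter (fun w => w ∈ P) = P := by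
    ext w
    simp only [Finset.mem_filter, Finset.mem_univ, true_and, and_iff_right_iff_imp]
    intro hw
    obtain ⟨j, hj, rfl⟩ := Finset.mem_image.1 hw
    exact hpu j (Finset.mem_Ico.1 hj).2
  rw [Finset.sum_add_distrib, Finset.sum_add_distrib, Finset.sum_const, smul_eq_mul, mul_one,
    ← Finset.sum_filter, hPsub, Finset.sum_const, smul_eq_mul, hPcard, mul_comm _ i] at hsum
  have hsplit := cost_add_distW M s r u
  have hru := hr u
  change cost s' M u + _ ≤ _ at hsum
  omega

end

/-- There is a constant `c > 0` such that in every stable wiring for a uniform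
`(n,k)`-BDNF game with `2 ≤ k < n`, the distance from a node of minimum cost
to any node is at most `c·√n`. -/
theorem stmt_8 :
    ∃ c : ℝ, 0 < c ∧
      ∀ n : ℕ, 2 ≤ n → ∀ k : ℕ, 2 ≤ k → k < n → ∀ M : ℕ, n ^ 2 < M →
        ∀ s : Fin n → Finset (Fin n), IsWiring k s → Stable k M s →
          ∀ r : Fin n, (∀ v : Fin n, cost s M r ≤ cost s M v) →
            ∀ v : Fin n, (distW s M r v : ℝ) ≤ c * Real.sqrt n := by
  refine ⟨2, two_pos, fun n hn k hk _ M hM s _ hs r hr v => ?_⟩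
  have hreach := hs.exists_connIn (by omega) (by rw [Fintype.card_fin]; nlinarith) hr
  obtain ⟨u, -, hu⟩ := Finset.exists_max_image Finset.univ (distW s M r) ⟨r, Finset.mem_univ r⟩
  have hfar : ∀ w, distW s M r w ≤ distW s M r u := fun w => hu w (Finset.mem_univ w)
  have hsq : distW s M r u ^ 2 ≤ 4 * n := by
    rcases Nat.eq_zero_or_pos (distW s M r u) with h0 | hpos
    · simp [h0]
    · have h := hs.mul_sub_lt_card hk hr hreach hfar (i := distW s M r u / 2) (by omega)
      rw [Fintype.card_fin] at h
      generalize distW s M r u = D at h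
      obtain ⟨a, rfl | rfl⟩ := D.even_or_odd'
      · rw [show 2 * a / 2 = a by omega, show 2 * a - a = a by omega] at h
        nlinarith
      · rw [show (2 * a + 1) / 2 = a by omega, show 2 * a + 1 - a = a + 1 by omega] at h
        nlinarith
  have hle : (distW s M r v : ℝ) ≤ distW s M r u := by exact_mod_cast hfar v
  refine hle.trans (abs_le_of_sq_le_sq' ?_ (by positivity) |>.2)
  rw [mul_pow, Real.sq_sqrt (Nat.cast_nonneg n)]
  norm_num
  exact_mod_cast hsq

end BDNF
end

section
/- Let n ≥ 2 and consider the uniform (n,1)-BDNF game. The directed Hamiltonian cycle wiring (identifying V with {0,…,n−1} and setting s(i) = {i+1 mod n}) is stable; moreover, every stable wiring for the uniform (n,1)-BDNF game is a single directed cycle through all n nodes (the out-map is a cyclic permutation of V), and its diameter is n−1. -/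
namespace BDNF

variable {V : Type} [DecidableEq V]

/-- The directed Hamiltonian cycle wiring on `{0, …, n-1}`: node `i` links to
`(i + 1) mod n`. -/
def hamCycle (n : ℕ) (hn : 0 < n) : Fin n → Finset (Fin n) :=
  fun i => {⟨((i : ℕ) + 1) % n, Nat.mod_lt _ hn⟩}

/-- There is a directed walk with exactly `m` edges from `v` to `u`. -/
def HasWalk (s : V → Finset V) : ℕ → V → V → Prop
  | 0, v, u => v = u
  | m + 1, v, u => ∃ w ∈ s v, HasWalk s m w u

theorem connIn_iff_hasWalk {V : Type} {s : V → Finset V} {m : ℕ} {v u : V} :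
    connIn s m v u ↔ ∃ j ≤ m, HasWalk s j v u := by
  induction m generalizing v with
  | zero => simp [connIn, HasWalk]
  | succ m ih =>
    simp only [connIn, ih]
    constructor
    · rintro (h | ⟨w, hw, j, hj, h⟩)
      · exact ⟨0, by omega, h⟩
      · exact ⟨j + 1, by omega, w, hw, h⟩
    · rintro ⟨_ | j, hj, h⟩
      · exact Or.inl h
      · obtain ⟨w, hw, h⟩ := h
        exact Or.inr ⟨w, hw, j, by omega, h⟩

theorem hasWalk_add {V : Type} {s : V → Finset V} {i j : ℕ} {v u : V} :
    HasWalk s (i + j) v u ↔ ∃ w, HasWalk s i v w ∧ HasWalk s j w u := by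
  induction i generalizing v with
  | zero => simp [HasWalk]
  | succ i ih =>
    rw [Nat.add_right_comm]
    simp only [HasWalk, ih]
    grind

theorem HasWalk.unique {V : Type} {s : V → Finset V} (hs : ∀ v, (s v).card ≤ 1) {j : ℕ}
    {v u u' : V} (h : HasWalk s j v u) (h' : HasWalk s j v u') : u = u' := by
  induction j generalizing v with
  | zero => exact h.symm.trans h'
  | succ j ih =>
    obtain ⟨w, hw, h⟩ := h
    obtain ⟨w', hw', h'⟩ := h'
    obtain rfl := Finset.card_le_one.mp (hs v) w hw w' hw'
    exact ih h h'

/-- A walk that leaves `v` at no step survives a rewiring of `v`. -/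
theorem HasWalk.update {s : V → Finset V} {v : V} (t : Finset V) {j : ℕ} {w u : V}
    (hv : ∀ i < j, ¬ HasWalk s i w v) (h : HasWalk s j w u) :
    HasWalk (Function.update s v t) j w u := by
  induction j generalizing w with
  | zero => exact h
  | succ j ih =>
    obtain ⟨x, hx, h⟩ := h
    have hwv : w ≠ v := hv 0 (by omega)
    exact ⟨x, by rwa [Function.update_of_ne hwv],
      ih (fun i hi hi' => hv (i + 1) (by omega) ⟨x, hx, hi'⟩) h⟩

/-- The distance to a reachable node is the length of a shortest walk. -/
theorem hasWalk_distW {V : Type} {s : V → Finset V} (M : ℕ) {v u : V} (h : ∃ j, HasWalk s j v u) :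
    HasWalk s (distW s M v u) v u ∧ ∀ j, HasWalk s j v u → distW s M v u ≤ j := by
  classical
  have hc : ∃ m, connIn s m v u :=
    h.imp fun j hj => connIn_iff_hasWalk.mpr ⟨j, le_rfl, hj⟩
  have hmin : ∀ j, HasWalk s j v u → distW s M v u ≤ j := fun j hj => by
    rw [distW, dif_pos hc]
    exact Nat.find_min' hc (connIn_iff_hasWalk.mpr ⟨j, le_rfl, hj⟩)
  refine ⟨?_, hmin⟩
  have hspec : connIn s (distW s M v u) v u := by
    rw [distW, dif_pos hc]
    exact Nat.find_spec hc
  obtain ⟨j, hj, hw⟩ := connIn_iff_hasWalk.mp hspec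
  rwa [le_antisymm (hmin j hw) hj]

theorem distW_of_not_hasWalk {V : Type} {s : V → Finset V} (M : ℕ) {v u : V}
    (h : ¬ ∃ j, HasWalk s j v u) : distW s M v u = M := by
  rw [distW, dif_neg]
  rintro ⟨m, hm⟩
  obtain ⟨j, -, hj⟩ := connIn_iff_hasWalk.mp hm
  exact h ⟨j, hj⟩

theorem eq_range_card_of_forall_lt_mem {A : Finset ℕ} (h : ∀ d ∈ A, ∀ i < d, i ∈ A) :
    A = Finset.range A.card := by
  refine Finset.eq_of_subset_of_card_le (fun d hd => ?_) (by simp)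
  have hsub : Finset.range (d + 1) ⊆ A := fun i hi => by
    rcases Nat.lt_succ_iff_lt_or_eq.mp (Finset.mem_range.mp hi) with hi | rfl
    · exact h d hd i hi
    · exact hd
  simpa using Finset.card_le_card hsub

theorem sum_range_add_mul_lt {N M r r' : ℕ} (hM : N ^ 2 < M) (hr : r < r') (hr' : r' ≤ N) :
    ∑ i ∈ Finset.range r', i + (N - r') * M < ∑ i ∈ Finset.range r, i + (N - r) * M := by
  have h1 : ∑ i ∈ Finset.range r', i ≤ N ^ 2 := by
    calc ∑ i ∈ Finset.range r', i ≤ (Finset.range r').card • N :=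
          Finset.sum_le_card_nsmul _ _ _ fun i hi => by
            have := Finset.mem_range.mp hi
            omega
      _ = r' * N := by simp
      _ ≤ N ^ 2 := by rw [pow_two]; exact Nat.mul_le_mul_right N hr'
  have h2 : (N - r' + 1) * M ≤ (N - r) * M := Nat.mul_le_mul_right M (by omega)
  rw [add_mul, one_mul] at h2
  omega

theorem card_update_le {s : V → Finset V} {k : ℕ} (hs : ∀ v, (s v).card ≤ k) (v : V)
    {t : Finset V} (ht : t.card ≤ k) (w : V) : (Function.update s v t w).card ≤ k := by
  rw [Function.update_apply]
  split_ifs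
  exacts [ht, hs w]

section Reach

variable [Fintype V]

open Classical in
/-- The set of nodes reachable from `v`, including `v` itself. -/
noncomputable def reach (s : V → Finset V) (v : V) : Finset V :=
  Finset.univ.filter fun u => ∃ j, HasWalk s j v u

theorem mem_reach {V : Type} [Fintype V] {s : V → Finset V} {v u : V} :
    u ∈ reach s v ↔ ∃ j, HasWalk s j v u := by
  simp [reach]

theorem self_mem_reach {V : Type} [Fintype V] (s : V → Finset V) (v : V) : v ∈ reach s v :=
  mem_reach.mpr ⟨0, rfl⟩

theorem reach_subset {V : Type} [Fintype V] {s : V → Finset V} {v w : V} (h : w ∈ reach s v) :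
    reach s w ⊆ reach s v := fun u hu => by
  obtain ⟨i, hi⟩ := mem_reach.mp h
  obtain ⟨j, hj⟩ := mem_reach.mp hu
  exact mem_reach.mpr ⟨i + j, hasWalk_add.mpr ⟨w, hi, hj⟩⟩

theorem mem_reach_of_mem {V : Type} [Fintype V] {s : V → Finset V} {v w : V} (h : w ∈ s v) :
    w ∈ reach s v :=
  mem_reach.mpr ⟨1, w, h, rfl⟩

theorem injOn_distW {V : Type} [Fintype V] {s : V → Finset V} (hs : ∀ v, (s v).card ≤ 1)
    (M : ℕ) (v : V) :
    Set.InjOn (distW s M v) (reach s v) := fun u hu u' hu' h => by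
  have hw := (hasWalk_distW M (mem_reach.mp hu)).1
  have hw' := (hasWalk_distW M (mem_reach.mp hu')).1
  rw [h] at hw
  exact hw.unique hs hw'

/-- With out-degree at most one, the distances from `v` to the nodes it reaches are
`0, 1, 2, …`, each attained once. -/
theorem image_distW_reach {V : Type} [Fintype V] {s : V → Finset V}
    (hs : ∀ v, (s v).card ≤ 1) (M : ℕ) (v : V) :
    (reach s v).image (distW s M v) = Finset.range (reach s v).card := by
  rw [← Finset.card_image_of_injOn (injOn_distW hs M v)]
  apply eq_range_card_of_forall_lt_mem
  intro d hd i hi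
  obtain ⟨u, hu, rfl⟩ := Finset.mem_image.mp hd
  obtain ⟨hwalk, hmin⟩ := hasWalk_distW M (mem_reach.mp hu)
  obtain ⟨k, hk⟩ := Nat.exists_eq_add_of_le hi.le
  rw [hk, hasWalk_add] at hwalk
  obtain ⟨w, hvw, hwu⟩ := hwalk
  obtain ⟨hw, hwmin⟩ := hasWalk_distW M ⟨i, hvw⟩
  refine Finset.mem_image.mpr ⟨w, mem_reach.mpr ⟨i, hvw⟩, ?_⟩
  have h1 := hwmin i hvw
  have h2 := hmin _ (hasWalk_add.mpr ⟨w, hw, hwu⟩)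
  omega

theorem cost_eq {s : V → Finset V} (hs : ∀ v, (s v).card ≤ 1) (M : ℕ) (v : V) :
    cost s M v = ∑ i ∈ Finset.range (reach s v).card, i
      + (Fintype.card V - (reach s v).card) * M := by
  have hvv : distW s M v v = 0 :=
    Nat.le_zero.mp ((hasWalk_distW M ⟨0, rfl⟩).2 0 rfl)
  have hcost : cost s M v = ∑ u, distW s M v u := by
    refine Finset.sum_subset (Finset.filter_subset _ _) fun u _ hu => ?_
    obtain rfl : u = v := by simpa using hu
    exact hvv
  rw [hcost, ← Finset.sum_add_sum_compl (reach s v)]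
  congr 1
  · rw [← image_distW_reach hs M v, Finset.sum_image (injOn_distW hs M v)]
  · rw [Finset.sum_congr rfl fun u hu => distW_of_not_hasWalk M
      fun h => Finset.mem_compl.mp hu (mem_reach.mpr h)]
    simp [Finset.card_compl]

theorem card_reach_le_of_cost_le {s s' : V → Finset V} (hs : ∀ v, (s v).card ≤ 1)
    (hs' : ∀ v, (s' v).card ≤ 1) {M : ℕ} (hM : Fintype.card V ^ 2 < M) {v : V}
    (h : cost s M v ≤ cost s' M v) : (reach s' v).card ≤ (reach s v).card := by
  by_contra! hlt
  have := sum_range_add_mul_lt hM hlt (Finset.card_le_univ _)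
  rw [cost_eq hs, cost_eq hs'] at h
  omega

theorem cost_le_of_reach_eq_univ {s s' : V → Finset V} (hs : ∀ v, (s v).card ≤ 1)
    (hs' : ∀ v, (s' v).card ≤ 1) {M : ℕ} (hM : Fintype.card V ^ 2 < M) {v : V}
    (h : reach s v = Finset.univ) : cost s M v ≤ cost s' M v := by
  by_contra! hlt
  have hcard := card_reach_le_of_cost_le hs' hs hM hlt.le
  have heq : (reach s' v).card = (reach s v).card :=
    le_antisymm (by rw [h]; exact Finset.card_le_univ _) hcard
  rw [cost_eq hs, cost_eq hs', heq] at hlt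
  exact lt_irrefl _ hlt

theorem Stable.card_reach_update_le {s : V → Finset V} {M : ℕ} (hst : Stable 1 M s)
    (hs : ∀ v, (s v).card ≤ 1) (hM : Fintype.card V ^ 2 < M) {v w : V} (hvw : v ≠ w) :
    (reach (Function.update s v {w}) v).card ≤ (reach s v).card :=
  card_reach_le_of_cost_le hs (card_update_le hs v (by simp)) hM
    (hst v {w} (by simpa using hvw) (by simp))

theorem stable_of_reach_eq_univ {s : V → Finset V} (hs : ∀ v, (s v).card ≤ 1) {M : ℕ}
    (hM : Fintype.card V ^ 2 < M) (h : ∀ v, reach s v = Finset.univ) : Stable 1 M s :=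
  fun v _ _ ht => cost_le_of_reach_eq_univ hs (card_update_le hs v ht) hM (h v)

/-- If `w` does not reach `v`, then after linking to `w`, `v` reaches itself and everything
`w` reaches. -/
theorem card_reach_lt_card_reach_update {s : V → Finset V} {v w : V} (h : v ∉ reach s w) :
    (reach s w).card < (reach (Function.update s v {w}) v).card := by
  apply Finset.card_lt_card
  refine (Finset.ssubset_iff_of_subset fun u hu => ?_).mpr ⟨v, self_mem_reach _ _, h⟩
  obtain ⟨j, hj⟩ := mem_reach.mp hu
  exact mem_reach.mpr ⟨j + 1, w, by simp,
    hj.update {w} fun i _ hi => h (mem_reach.mpr ⟨i, hi⟩)⟩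

/-- If `w ∉ reach s x` links to `x`, then some node `p` reachable from `x` can reach `w` and all
of `reach s x` by linking to `w`: take `p` farthest from `x`. -/
theorem exists_card_reach_lt_card_reach_update {s : V → Finset V} {w x : V} (hx : x ∈ s w)
    (hw : w ∉ reach s x) :
    ∃ p ∈ reach s x, (reach s x).card < (reach (Function.update s p {w}) p).card := by
  obtain ⟨p, hp, hmax⟩ := (reach s x).exists_max_image (distW s 0 x) ⟨x, self_mem_reach s x⟩
  refine ⟨p, hp, Finset.card_lt_card ?_⟩
  have hwp : w ≠ p := fun h => hw (h ▸ hp)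
  refine (Finset.ssubset_iff_of_subset fun u hu => ?_).mpr
    ⟨w, mem_reach_of_mem (by simp), hw⟩
  have hwalk := (hasWalk_distW 0 (mem_reach.mp hu)).1
  have hle := hmax u hu
  refine mem_reach.mpr ⟨_ + 1 + 1, w, by simp, x, by rwa [Function.update_of_ne hwp],
    hwalk.update {w} fun i hi hip => ?_⟩
  have := (hasWalk_distW 0 (mem_reach.mp hp)).2 i hip
  omega

theorem Stable.reach_eq_univ {s : V → Finset V} {M : ℕ} (hst : Stable 1 M s)
    (hs : ∀ v, (s v).card ≤ 1) (hM : Fintype.card V ^ 2 < M) (v : V) :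
    reach s v = Finset.univ := by
  obtain ⟨a, -, hmin⟩ := Finset.univ.exists_min_image (fun v => (reach s v).card)
    ⟨v, Finset.mem_univ v⟩
  have hmin : ∀ w, (reach s a).card ≤ (reach s w).card := fun w => hmin w (Finset.mem_univ w)
  suffices ha : reach s a = Finset.univ by
    refine Finset.eq_univ_of_card _ (le_antisymm (Finset.card_le_univ _) ?_)
    simpa [ha] using hmin v
  by_contra hne
  obtain ⟨w, hw⟩ : ∃ w, w ∉ reach s a := by
    by_contra! h
    exact hne (Finset.eq_univ_of_forall h)
  by_cases hentry : ∃ w x, w ∉ reach s a ∧ x ∈ s w ∧ x ∈ reach s a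
  · obtain ⟨w, x, hw, hx, hxa⟩ := hentry
    have hreach : reach s x = reach s a :=
      Finset.eq_of_subset_of_card_le (reach_subset hxa) (hmin x)
    rw [← hreach] at hw
    obtain ⟨p, hp, hlt⟩ := exists_card_reach_lt_card_reach_update hx hw
    have hpw : p ≠ w := fun h => hw (h ▸ hp)
    have h1 := hst.card_reach_update_le hs hM hpw
    have h2 := Finset.card_le_card (reach_subset hp)
    omega
  · push Not at hentry
    have hclosed : ∀ j w u, w ∉ reach s a → HasWalk s j w u → u ∉ reach s a := by
      intro j
      induction j with
      | zero => rintro w u hw rfl; exact hw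
      | succ j ih =>
        rintro w u hw ⟨x, hx, h⟩
        exact ih x u (hentry w x hw hx) h
    have haw : a ∉ reach s w := fun h => by
      obtain ⟨j, hj⟩ := mem_reach.mp h
      exact hclosed j w a hw hj (self_mem_reach s a)
    have h1 := card_reach_lt_card_reach_update haw
    have h2 := hst.card_reach_update_le hs hM
      (show a ≠ w from fun h => hw (h ▸ self_mem_reach s a))
    have h3 := hmin w
    omega

theorem exists_perm_of_reach_eq_univ [Nontrivial V] {s : V → Finset V} (hs : IsWiring 1 s)
    (h : ∀ v, reach s v = Finset.univ) :
    ∃ σ : Equiv.Perm V, σ.IsCycle ∧ σ.support = Finset.univ ∧ ∀ v, s v = {σ v} := by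
  have hwalk : ∀ v u, ∃ j, HasWalk s j v u := fun v u =>
    mem_reach.mp (h v ▸ Finset.mem_univ u)
  have hpos : ∀ v u, v ≠ u → ∃ j, HasWalk s (j + 1) v u := fun v u hvu => by
    obtain ⟨_ | j, hj⟩ := hwalk v u
    · exact absurd hj hvu
    · exact ⟨j, hj⟩
  have hsingle : ∀ v, ∃ w, s v = {w} := fun v => by
    obtain ⟨u, hu⟩ := exists_ne v
    obtain ⟨j, w, hw, -⟩ := hpos v u hu.symm
    exact Finset.card_eq_one.mp
      (le_antisymm (hs v).2 (Finset.card_pos.mpr ⟨w, hw⟩))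
  choose f hf using hsingle
  have hsurj : Function.Surjective f := fun u => by
    obtain ⟨v, hv⟩ := exists_ne u
    obtain ⟨j, hj⟩ := hpos v u hv
    obtain ⟨w, -, x, hx, rfl⟩ := hasWalk_add.mp hj
    rw [hf, Finset.mem_singleton] at hx
    exact ⟨w, hx.symm⟩
  let σ : Equiv.Perm V := Equiv.ofBijective f (Finite.surjective_iff_bijective.mp hsurj)
  have hσ : ∀ v, s v = {σ v} := hf
  have hne : ∀ v, σ v ≠ v := fun v hv => (hs v).1 (by rw [hσ, hv]; simp)
  have hpow : ∀ j v u, HasWalk s j v u → (σ ^ j) v = u := by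
    intro j
    induction j with
    | zero => intro v u h; exact h
    | succ j ih =>
      rintro v u ⟨w, hw, h⟩
      rw [hσ, Finset.mem_singleton] at hw
      rw [pow_succ, Equiv.Perm.mul_apply, ← hw]
      exact ih w u h
  refine ⟨σ, ?_, ?_, hσ⟩
  · obtain ⟨x⟩ : Nonempty V := inferInstance
    refine ⟨x, hne x, fun y _ => ?_⟩
    obtain ⟨j, hj⟩ := hwalk x y
    exact ⟨j, by simpa using hpow j x y hj⟩
  · exact Finset.eq_univ_of_forall fun v => Equiv.Perm.mem_support.mpr (hne v)

end Reach

theorem isWiring_hamCycle {n : ℕ} (hn₀ : 0 < n) (hn : 2 ≤ n) : IsWiring 1 (hamCycle n hn₀) := by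
  refine fun v => ⟨fun h => ?_, by simp [hamCycle]⟩
  have hv := congrArg Fin.val (Finset.mem_singleton.mp h)
  simp only at hv
  have hlt := v.isLt
  rcases Nat.lt_or_ge ((v : ℕ) + 1) n with h1 | h1
  · rw [Nat.mod_eq_of_lt h1] at hv
    omega
  · rw [show (v : ℕ) + 1 = n by omega, Nat.mod_self] at hv
    omega

theorem hasWalk_hamCycle {n : ℕ} (hn : 0 < n) (j : ℕ) (v : Fin n) :
    HasWalk (hamCycle n hn) j v ⟨((v : ℕ) + j) % n, Nat.mod_lt _ hn⟩ := by
  induction j generalizing v with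
  | zero => exact Fin.ext (Nat.mod_eq_of_lt v.isLt).symm
  | succ j ih =>
    refine ⟨_, Finset.mem_singleton_self _, ?_⟩
    convert ih _ using 2
    simp [add_assoc, add_comm 1 j]

theorem reach_hamCycle {n : ℕ} (hn : 0 < n) (v : Fin n) :
    reach (hamCycle n hn) v = Finset.univ := by
  refine Finset.eq_univ_of_forall fun u => mem_reach.mpr ⟨n - v + u, ?_⟩
  convert hasWalk_hamCycle hn (n - v + u) v
  have := v.isLt
  rw [show (v : ℕ) + (n - v + u) = u + n by omega, Nat.add_mod_right, Nat.mod_eq_of_lt u.isLt]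

/-- For `n ≥ 2` and `k = 1`: the directed Hamiltonian cycle wiring is stable;
moreover every stable wiring for the uniform `(n,1)`-BDNF game is a single
directed cycle through all `n` nodes (the out-map is a cyclic permutation of
the node set), and its diameter is `n - 1`. -/
theorem stmt_15 :
    ∀ n : ℕ, ∀ hn : 2 ≤ n, ∀ M : ℕ, n ^ 2 < M →
      (IsWiring 1 (hamCycle n (by omega)) ∧
        Stable 1 M (hamCycle n (by omega))) ∧
      (∀ s : Fin n → Finset (Fin n), IsWiring 1 s → Stable 1 M s →
        (∃ σ : Equiv.Perm (Fin n), σ.IsCycle ∧ σ.support = Finset.univ ∧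
          ∀ v : Fin n, s v = {σ v}) ∧
        (∀ u v : Fin n, distW s M u v ≤ n - 1) ∧
        (∃ u v : Fin n, distW s M u v = n - 1)) := by
  intro n hn M hM
  have hM' : Fintype.card (Fin n) ^ 2 < M := by simpa using hM
  have : Nontrivial (Fin n) := Fin.nontrivial_iff_two_le.mpr hn
  refine ⟨⟨isWiring_hamCycle _ hn, stable_of_reach_eq_univ
    (fun v => (isWiring_hamCycle _ hn v).2) hM' (reach_hamCycle _)⟩, fun s hs hst => ?_⟩
  have hdeg : ∀ v, (s v).card ≤ 1 := fun v => (hs v).2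
  have hreach := hst.reach_eq_univ hdeg hM'
  have himage : ∀ u, Finset.univ.image (distW s M u) = Finset.range n := fun u => by
    simpa [hreach u] using image_distW_reach hdeg M u
  refine ⟨exists_perm_of_reach_eq_univ hs hreach, fun u v => ?_, ?_⟩
  · have hmem := Finset.mem_image_of_mem (distW s M u) (Finset.mem_univ v)
    rw [himage, Finset.mem_range] at hmem
    omega
  · have hmem : n - 1 ∈ Finset.range n := Finset.mem_range.mpr (by omega)
    rw [← himage ⟨0, by omega⟩] at hmem
    obtain ⟨v, -, hv⟩ := Finset.mem_image.mp hmem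
    exact ⟨_, v, hv⟩

end BDNF
end
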